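/- arXiv:1109.4015 — 3 statements merged into one kernel-verified Lean document; each statement's English description precedes it below -/
import Mathlib

section
/- Let J ⊆ E be a stable monomial ideal with J ≠ 0 and J containing no variable e_i, and suppose J has at least one minimal monomial generator of degree 2. Set t = max{max(u) : u ∈ G(J)_2}. Then the first resonance variety of E/J equals the K-linear span of e_1, …, e_t, i.e. R^1(E/J) = span_K{e_1, …, e_t}; in particular R^1(E/J) is a K-linear subspace of E_1 (hence irreducible). -/
open scoped BigOperators

noncomputable section

/-- The exterior algebra `E = Λ(K^n)`. -/
abbrev ExtE (K : Type*) [Field K] (n : ℕ) := ExteriorAlgebra K (Fin n → K)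

/-- The generator `e_i` of the exterior algebra. -/
noncomputable def eVar (K : Type*) [Field K] (n : ℕ) (i : Fin n) : ExtE K n :=
  ExteriorAlgebra.ι K (Pi.single i 1)

/-- The monomial `e_F = e_{i_1} ∧ ⋯ ∧ e_{i_p}` for `F = {i_1 < ⋯ < i_p}`. -/
noncomputable def eMonF (K : Type*) [Field K] (n : ℕ) (F : Finset (Fin n)) : ExtE K n :=
  ((F.sort (· ≤ ·)).map (eVar K n)).prod

/-- The `p`-th graded component `E_p` of the exterior algebra. -/
noncomputable def eGrade (K : Type*) [Field K] (n : ℕ) (p : ℕ) : Submodule K (ExtE K n) :=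
  (LinearMap.range (ExteriorAlgebra.ι K : (Fin n → K) →ₗ[K] ExtE K n)) ^ p

/-- The two-sided ideal of `E` generated by a set `S`, as a `K`-submodule of `E`. -/
noncomputable def tsIdeal (K : Type*) [Field K] (n : ℕ) (S : Set (ExtE K n)) :
    Submodule K (ExtE K n) :=
  Submodule.span K {x : ExtE K n | ∃ a s b : ExtE K n, s ∈ S ∧ x = a * s * b}

/-- `∂e_F = ∑_{j=1}^t (−1)^{j−1} e_{F∖{i_j}}` for `F = {i_1 < ⋯ < i_t}`. -/
noncomputable def osDelta (K : Type*) [Field K] (n : ℕ) (F : Finset (Fin n)) : ExtE K n :=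
  ∑ k ∈ F, ((-1 : K) ^ (F.filter (fun j => j < k)).card) • eMonF K n (F.erase k)

/-- The first resonance variety `R^1(E/J)` of `E/J`, viewed inside `E_1`. -/
noncomputable def resonance1 (K : Type*) [Field K] (n : ℕ) (J : Submodule K (ExtE K n)) :
    Set (ExtE K n) :=
  {u | u ∈ eGrade K n 1 ∧ (u = 0 ∨ ∃ v ∈ eGrade K n 1, u * v ∈ J ∧ u * v ≠ 0)}

/-- The `q`-th resonance variety `R^q(E/J)` of `E/J` for `q ≥ 1`, viewed inside `E_1`. -/
noncomputable def resonanceQ (K : Type*) [Field K] (n : ℕ) (J : Submodule K (ExtE K n))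
    (q : ℕ) : Set (ExtE K n) :=
  {u | u ∈ eGrade K n 1 ∧ (u = 0 ∨ ∃ v ∈ eGrade K n q, v ∉ J ∧
    (¬ ∃ w ∈ eGrade K n (q - 1), v = u * w) ∧ u * v ∈ J ∧ u * v ≠ 0)}

/-- The rank variety `V_E(E/J)`, viewed inside `E_1`. -/
noncomputable def rankVar (K : Type*) [Field K] (n : ℕ) (J : Submodule K (ExtE K n)) :
    Set (ExtE K n) :=
  {u | u ∈ eGrade K n 1 ∧ ∃ w : ExtE K n, u * w ∈ J ∧
    ¬ ∃ j ∈ J, ∃ x : ExtE K n, w = j + u * x}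

/-- Projection to two coordinates. -/
def prK (K : Type*) [Field K] (n : ℕ) (k j : Fin n) : (Fin n → K) →ₗ[K] (Fin 2 → K) :=
  LinearMap.funLeft K K ![k, j]

theorem det_of_mul {K : Type*} [Field K] (x y : Fin 2 → K)
    (h : ExteriorAlgebra.ι K x * ExteriorAlgebra.ι K y = 0) : x 0 * y 1 = x 1 * y 0 := by
  classical
  let f : ∀ i, (Fin 2 → K) [⋀^Fin i]→ₗ[K] K := fun i =>
    if hi : i = 2 then hi ▸ (Matrix.detRowAlternating (R := K) (n := Fin 2)) else 0
  have h2 : ExteriorAlgebra.ιMulti K 2 ![x, y] = 0 := by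
    rw [ExteriorAlgebra.ιMulti_apply]; simpa using h
  have h3 := congrArg (ExteriorAlgebra.liftAlternating f) h2
  rw [ExteriorAlgebra.liftAlternating_apply_ιMulti, map_zero] at h3
  have h4 : Matrix.det (Matrix.of ![x, y]) = 0 := h3
  rw [Matrix.det_fin_two] at h4
  simp at h4
  linear_combination h4

theorem det_of_map {K : Type*} [Field K] {n : ℕ} (k j : Fin n) (a b : Fin n → K)
    (h : ExteriorAlgebra.map (prK K n k j) (ExteriorAlgebra.ι K a * ExteriorAlgebra.ι K b) = 0) :
    a k * b j = a j * b k := by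
  rw [map_mul, ExteriorAlgebra.map_apply_ι, ExteriorAlgebra.map_apply_ι] at h
  have := det_of_mul _ _ h
  simpa [prK, LinearMap.funLeft_apply] using this

theorem map_mon_zero {K : Type*} [Field K] {n : ℕ} (k j : Fin n) (F : Finset (Fin n))
    (hF : ¬ F ⊆ {k, j}) : ExteriorAlgebra.map (prK K n k j) (eMonF K n F) = 0 := by
  obtain ⟨i, hi, hi'⟩ := Finset.not_subset.1 hF
  simp only [Finset.mem_insert, Finset.mem_singleton, not_or] at hi'
  rw [eMonF, map_list_prod]
  apply List.prod_eq_zero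
  rw [List.map_map, List.mem_map]
  refine ⟨i, by simpa using hi, ?_⟩
  have : prK K n k j (Pi.single i 1) = 0 := by
    ext m
    fin_cases m
    · simp [prK, LinearMap.funLeft_apply, Pi.single_apply, Ne.symm hi'.1]
    · simp [prK, LinearMap.funLeft_apply, Pi.single_apply, Ne.symm hi'.2]
  simp [eVar, ExteriorAlgebra.map_apply_ι, this]

theorem ideal_map_zero {K : Type*} [Field K] {n : ℕ} (k j : Fin n) (G : Set (Finset (Fin n)))
    (hG : ∀ F ∈ G, ¬ F ⊆ {k, j}) (x : ExtE K n) (hx : x ∈ tsIdeal K n (eMonF K n '' G)) :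
    ExteriorAlgebra.map (prK K n k j) x = 0 := by
  have : tsIdeal K n (eMonF K n '' G) ≤
      LinearMap.ker (ExteriorAlgebra.map (prK K n k j)).toLinearMap := by
    apply Submodule.span_le.2
    rintro _ ⟨a, _, b, ⟨F, hF, rfl⟩, rfl⟩
    simp [map_mon_zero k j F (hG F hF)]
  exact this hx

theorem eVar_anti {K : Type*} [Field K] {n : ℕ} (i j : Fin n) :
    eVar K n i * eVar K n j = - (eVar K n j * eVar K n i) := by
  have := ExteriorAlgebra.ι_add_mul_swap (R := K) (M := Fin n → K) (Pi.single i 1) (Pi.single j 1)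
  exact eq_neg_of_add_eq_zero_left this

theorem mon_pair {K : Type*} [Field K] {n : ℕ} (i j : Fin n) (h : i < j) :
    eMonF K n {i, j} = eVar K n i * eVar K n j := by
  have : ({i, j} : Finset (Fin n)).sort (· ≤ ·) = [i, j] := by
    rw [Finset.sort_insert]
    · simp
    · intro b hb; simp at hb; subst hb; exact h.le
    · simp [h.ne]
  rw [eMonF, this]; simp

theorem mon_pair_mem {K : Type*} [Field K] {n : ℕ} (J : Submodule K (ExtE K n)) (i j : Fin n)
    (h : i ≠ j) (hm : eMonF K n {i, j} ∈ J) : eVar K n i * eVar K n j ∈ J := by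
  rcases lt_or_gt_of_ne h with h | h
  · rwa [mon_pair i j h] at hm
  · rw [Finset.pair_comm, mon_pair j i h] at hm
    rw [eVar_anti]; exact J.neg_mem hm

theorem iota_sum {K : Type*} [Field K] {n : ℕ} (a : Fin n → K) :
    ExteriorAlgebra.ι K a = ∑ i, a i • eVar K n i := by
  conv_lhs => rw [pi_eq_sum_univ' a]
  rw [map_sum]
  refine Finset.sum_congr rfl fun i _ => ?_
  rw [map_smul, eVar]

/-- For a stable monomial ideal `J ⊆ E` (nonzero, containing no variable),
with `t = max{max(u) : u ∈ G(J)_2}`, the first resonance variety of `E/J` equals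
`span_K{e_1, …, e_t}`. -/
theorem stmt0 {K : Type*} [Field K] [CharZero K] {n : ℕ}
    (G : Finset (Finset (Fin n))) (J : Submodule K (ExtE K n))
    (hJ : J = tsIdeal K n (eMonF K n '' (G : Set (Finset (Fin n)))))
    (hmin : ∀ F ∈ G, ∀ F' ∈ G, F ⊆ F' → F = F')
    (hJne : J ≠ ⊥)
    (hvar : ∀ i : Fin n, eVar K n i ∉ J)
    (hstab : ∀ (F : Finset (Fin n)) (hF : F.Nonempty), eMonF K n F ∈ J →
      ∀ j : Fin n, j < F.max' hF → j ∉ F →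
        eMonF K n (insert j (F.erase (F.max' hF))) ∈ J)
    (t : Fin n)
    (ht : IsGreatest {i : Fin n | ∃ F ∈ G, F.card = 2 ∧ i ∈ F} t) :
    resonance1 K n J =
      (Submodule.span K (eVar K n '' {i : Fin n | i ≤ t}) : Set (ExtE K n)) := by
  have hgen : ∀ F ∈ G, eMonF K n F ∈ J := by
    intro F hF
    rw [hJ]
    exact Submodule.subset_span ⟨1, _, 1, ⟨F, hF, rfl⟩, by simp⟩
  have hcard : ∀ F ∈ G, 2 ≤ F.card := by
    intro F hF
    by_contra hc
    have : F.card = 0 ∨ F.card = 1 := by omega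
    rcases this with h | h
    · rw [Finset.card_eq_zero] at h
      subst h
      apply hvar t
      rw [hJ]
      exact Submodule.subset_span ⟨1, _, eVar K n t, ⟨∅, hF, rfl⟩, by simp [eMonF]⟩
    · obtain ⟨i, rfl⟩ := Finset.card_eq_one.1 h
      have := hgen _ hF
      simp only [eMonF, Finset.sort_singleton, List.map_cons, List.map_nil, List.prod_cons,
        List.prod_nil, mul_one] at this
      exact hvar i this
  obtain ⟨⟨F, hFG, hF2, htF⟩, hub⟩ := ht
  obtain ⟨s, hst, rfl⟩ : ∃ s, s ≠ t ∧ F = {s, t} := by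
    obtain ⟨x, y, hxy, rfl⟩ := Finset.card_eq_two.1 hF2
    simp only [Finset.mem_insert, Finset.mem_singleton] at htF
    rcases htF with rfl | rfl
    · exact ⟨y, hxy.symm, Finset.pair_comm _ _⟩
    · exact ⟨x, hxy, rfl⟩
  have hslt : s < t := lt_of_le_of_ne (hub ⟨_, hFG, hF2, by simp⟩) hst
  have hsq : ∀ i : Fin n, eVar K n i * eVar K n i = 0 := fun i =>
    ExteriorAlgebra.ι_sq_zero _
  have hmem : ∀ j, j ≤ t → eVar K n s * eVar K n j ∈ J := by
    intro j hj
    rcases eq_or_ne j s with rfl | hjs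
    · rw [hsq]; exact J.zero_mem
    rcases hj.eq_or_lt with rfl | hjt
    · exact mon_pair_mem J _ _ hst (hgen _ hFG)
    have hmax : ({s, t} : Finset (Fin n)).max' ⟨s, by simp⟩ = t := by
      apply le_antisymm
      · apply Finset.max'_le
        intro y hy
        simp only [Finset.mem_insert, Finset.mem_singleton] at hy
        rcases hy with rfl | rfl
        · exact hslt.le
        · exact le_rfl
      · exact Finset.le_max' _ _ (by simp)
    have h := hstab {s, t} ⟨s, by simp⟩ (hgen _ hFG) j (by rw [hmax]; exact hjt)
      (by simp [hjs, hjt.ne])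
    rw [hmax] at h
    have he : ({s, t} : Finset (Fin n)).erase t = {s} := by
      ext y
      simp only [Finset.mem_erase, Finset.mem_insert, Finset.mem_singleton]
      constructor
      · rintro ⟨h1, h2 | h2⟩
        · exact h2
        · exact absurd h2 h1
      · rintro rfl; exact ⟨hst, Or.inl rfl⟩
    rw [he, Finset.pair_comm] at h
    exact mon_pair_mem J _ _ hjs.symm h
  have hgr : ∀ u : ExtE K n, u ∈ eGrade K n 1 ↔ ∃ a : Fin n → K, ExteriorAlgebra.ι K a = u := by
    intro u; rw [eGrade, pow_one]; rfl
  ext u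
  constructor
  · rintro ⟨hu, hu0 | ⟨v, hv, huv, hne⟩⟩
    · subst hu0; exact Submodule.zero_mem _
    obtain ⟨a, rfl⟩ := (hgr _).1 hu
    obtain ⟨b, rfl⟩ := (hgr _).1 hv
    have key : ∀ k, t < k → a k = 0 := by
      intro k hk
      by_contra hak
      apply hne
      have hdet : ∀ j, a k * b j = a j * b k := by
        intro j
        apply det_of_map k j
        apply ideal_map_zero k j (G : Set (Finset (Fin n))) _ _ (hJ ▸ huv)
        intro F hF hsub
        have h1 := hcard F hF
        have h2 := Finset.card_le_two (a := k) (b := j)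
        have h3 : F = {k, j} := Finset.eq_of_subset_of_card_le hsub (h2.trans h1)
        have h4 : F.card = 2 := le_antisymm (h3 ▸ h2) h1
        exact absurd (hub ⟨F, hF, h4, by rw [h3]; simp⟩) (not_le.2 hk)
      have hb : b = (b k / a k) • a := by
        ext j
        have := hdet j
        simp only [Pi.smul_apply, smul_eq_mul]
        field_simp
        linear_combination this
      rw [hb, map_smul, mul_smul_comm, ExteriorAlgebra.ι_sq_zero, smul_zero]
    rw [SetLike.mem_coe, iota_sum]
    apply Submodule.sum_mem
    intro i _
    rcases le_or_gt i t with hi | hi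
    · exact Submodule.smul_mem _ _ (Submodule.subset_span ⟨i, hi, rfl⟩)
    · rw [key i hi, zero_smul]; exact Submodule.zero_mem _
  · intro hu
    rw [SetLike.mem_coe] at hu
    have hu1 : u ∈ eGrade K n 1 := by
      refine (Submodule.span_le.2 ?_) hu
      rintro _ ⟨i, _, rfl⟩
      exact (hgr _).2 ⟨_, rfl⟩
    refine ⟨hu1, ?_⟩
    by_cases hu0 : u = 0
    · exact Or.inl hu0
    right
    have hus : u * eVar K n s ∈ J := by
      refine (Submodule.span_le (p := J.comap (LinearMap.mulRight K (eVar K n s)))).2 ?_ hu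
      rintro _ ⟨i, hi, rfl⟩
      simp only [SetLike.mem_coe, Submodule.mem_comap, LinearMap.mulRight_apply]
      rw [eVar_anti]
      exact J.neg_mem (hmem i hi)
    by_cases hz : u * eVar K n s = 0
    swap
    · exact ⟨_, (hgr _).2 ⟨_, rfl⟩, hus, hz⟩
    obtain ⟨a, rfl⟩ := (hgr _).1 hu1
    have ha : ∀ j, j ≠ s → a j = 0 := by
      intro j hj
      have := det_of_map s j a (Pi.single s 1) (by rw [eVar] at hz; rw [hz, map_zero])
      simpa [Pi.single_apply, hj] using this.symm
    have hua : ExteriorAlgebra.ι K a = a s • eVar K n s := by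
      rw [iota_sum, Finset.sum_eq_single s]
      · intro j _ hj; rw [ha j hj, zero_smul]
      · simp
    refine ⟨eVar K n t, (hgr _).2 ⟨_, rfl⟩, ?_, ?_⟩
    · rw [hua, smul_mul_assoc]
      exact J.smul_mem _ (hmem t le_rfl)
    · intro h0
      have := det_of_map s t a (Pi.single t 1) (by rw [eVar] at h0; rw [h0, map_zero])
      have h5 : a s = 0 := by simpa [Pi.single_apply, hst] using this
      exact hu0 (by rw [hua, h5, zero_smul])
end
end

section
/- Let J ⊆ E be a stable monomial ideal, all of whose minimal monomial generators have the same degree p ≥ 2, and set t = max{max(u) : u ∈ G(J)}. Then the (p−1)-st resonance variety of E/J is maximal: R^{p−1}(E/J) = V_E(E/J), and both sets equal span_K{e_1, …, e_t}; in particular R^{p−1}(E/J) is irreducible. -/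
open scoped BigOperators

noncomputable section

section helpers
variable {K : Type*} [Field K] {n : ℕ}

theorem aux_anti (v w : Fin n → K) :
    ExteriorAlgebra.ι K v * ExteriorAlgebra.ι K w
      = -(ExteriorAlgebra.ι K w * ExteriorAlgebra.ι K v) :=
  eq_neg_of_add_eq_zero_left (ExteriorAlgebra.ι_add_mul_swap v w)

theorem aux_comm1 (v : Fin n → K) (a : ExtE K n) :
    ∃ a' : ExtE K n, a * ExteriorAlgebra.ι K v = ExteriorAlgebra.ι K v * a' := by
  induction a using ExteriorAlgebra.induction with
  | algebraMap r => exact ⟨algebraMap K _ r, Algebra.commutes _ _⟩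
  | ι x => exact ⟨-ExteriorAlgebra.ι K x, by rw [aux_anti, mul_neg]⟩
  | mul a b ha hb =>
    obtain ⟨a', ha⟩ := ha
    obtain ⟨b', hb⟩ := hb
    exact ⟨a' * b', by rw [mul_assoc, hb, ← mul_assoc, ha, mul_assoc]⟩
  | add a b ha hb =>
    obtain ⟨a', ha⟩ := ha
    obtain ⟨b', hb⟩ := hb
    exact ⟨a' + b', by rw [add_mul, ha, hb, mul_add]⟩

theorem aux_comm (l : List (Fin n)) (a : ExtE K n) :
    ∃ a' : ExtE K n, a * (l.map (eVar K n)).prod = (l.map (eVar K n)).prod * a' := by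
  induction l generalizing a with
  | nil => exact ⟨a, by simp⟩
  | cons i l ih =>
    obtain ⟨b, hb⟩ := aux_comm1 (Pi.single i 1) a
    obtain ⟨c, hc⟩ := ih b
    refine ⟨c, ?_⟩
    rw [List.map_cons, List.prod_cons, ← mul_assoc]
    unfold eVar at *
    rw [hb, mul_assoc, hc, mul_assoc]

/-- coordinate functional -/
def auxD (K : Type*) [Field K] {n : ℕ} (k : Fin n) : Module.Dual K (Fin n → K) :=
  LinearMap.proj k

/-- contraction -/
def auxC (K : Type*) [Field K] {n : ℕ} (k : Fin n) : ExtE K n →ₗ[K] ExtE K n :=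
  CliffordAlgebra.contractLeft (Q := (0 : QuadraticForm K (Fin n → K))) (auxD K k)

theorem auxC_mul (k : Fin n) (x : Fin n → K) (b : ExtE K n) :
    auxC K k (ExteriorAlgebra.ι K x * b) = x k • b - ExteriorAlgebra.ι K x * auxC K k b :=
  CliffordAlgebra.contractLeft_ι_mul _ _ _

theorem auxC_one (k : Fin n) : auxC K k 1 = 0 :=
  CliffordAlgebra.contractLeft_one _ _

theorem auxC_list (k : Fin n) (l : List (Fin n)) (hk : k ∉ l) (b : ExtE K n) :
    ∃ c : K, auxC K k ((l.map (eVar K n)).prod * b) = (l.map (eVar K n)).prod * (c • auxC K k b) := by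
  induction l with
  | nil => exact ⟨1, by simp⟩
  | cons i l ih =>
    simp only [List.mem_cons, not_or] at hk
    obtain ⟨c, hc⟩ := ih hk.2
    refine ⟨-c, ?_⟩
    rw [List.map_cons, List.prod_cons, mul_assoc]
    conv_lhs => rw [eVar, auxC_mul, hc]
    rw [Pi.single_eq_of_ne hk.1, mul_assoc, eVar]
    simp

theorem auxC_mon (k : Fin n) (F : Finset (Fin n)) (hk : k ∉ F) : auxC K k (eMonF K n F) = 0 := by
  obtain ⟨c, hc⟩ := auxC_list (K := K) k (F.sort (· ≤ ·)) (by simpa using hk) 1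
  rw [auxC_one, smul_zero, mul_zero, mul_one] at hc
  exact hc

theorem aux_list_ne (l : List (Fin n)) (hl : l.Nodup) : (l.map (eVar K n)).prod ≠ 0 := by
  induction l with
  | nil => simp
  | cons i l ih =>
    rw [List.nodup_cons] at hl
    intro h
    rw [List.map_cons, List.prod_cons, eVar] at h
    have h2 := congrArg (auxC K i) h
    obtain ⟨c, hc⟩ := auxC_list (K := K) i l hl.1 1
    rw [auxC_one, smul_zero, mul_zero, mul_one] at hc
    rw [auxC_mul, hc] at h2
    simp at h2
    exact ih hl.2 (by simpa using h2)

theorem aux_mul_ne (x : Fin n → K) (k : Fin n) (hx : x k ≠ 0) (F : Finset (Fin n)) (hk : k ∉ F) :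
    ExteriorAlgebra.ι K x * eMonF K n F ≠ 0 := by
  intro h
  have h2 := congrArg (auxC K k) h
  rw [auxC_mul, auxC_mon k F hk, mul_zero, sub_zero, map_zero, smul_eq_zero] at h2
  exact aux_list_ne _ (Finset.sort_nodup _ _) (h2.resolve_left hx)

theorem aux_perm {l l' : List (Fin n)} (h : l.Perm l') :
    ∃ c : K, (l.map (eVar K n)).prod = c • (l'.map (eVar K n)).prod := by
  induction h with
  | nil => exact ⟨1, by simp⟩
  | cons i _ ih =>
    obtain ⟨c, hc⟩ := ih
    exact ⟨c, by simp [hc]⟩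
  | swap i j l =>
    refine ⟨-1, ?_⟩
    simp only [List.map_cons, List.prod_cons, ← mul_assoc]
    rw [eVar, eVar, aux_anti]
    simp
  | trans _ _ ih1 ih2 =>
    obtain ⟨c, hc⟩ := ih1
    obtain ⟨d, hd⟩ := ih2
    exact ⟨c * d, by rw [hc, hd, smul_smul]⟩

theorem aux_insert (j : Fin n) (F : Finset (Fin n)) (hj : j ∉ F) :
    ∃ c : K, eVar K n j * eMonF K n F = c • eMonF K n (insert j F) := by
  have hp : (j :: F.sort (· ≤ ·)).Perm ((insert j F).sort (· ≤ ·)) := by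
    rw [List.perm_ext_iff_of_nodup]
    · intro a; simp
    · simp [hj]
    · exact Finset.sort_nodup _ _
  obtain ⟨c, hc⟩ := aux_perm (K := K) hp
  exact ⟨c, by simpa [eMonF] using hc⟩

theorem aux_mul_mem (j : Fin n) (F : Finset (Fin n)) (hj : j ∈ F) :
    eVar K n j * eMonF K n F = 0 := by
  have hp : (F.sort (· ≤ ·)).Perm (j :: (F.erase j).sort (· ≤ ·)) := by
    rw [List.perm_ext_iff_of_nodup]
    · intro a; by_cases h : a = j <;> simp [h, hj]
    · exact Finset.sort_nodup _ _
    · simp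
  obtain ⟨c, hc⟩ := aux_perm (K := K) hp
  rw [eMonF, hc, List.map_cons, List.prod_cons, mul_smul_comm, ← mul_assoc, eVar,
    ExteriorAlgebra.ι_sq_zero]
  simp

theorem aux_mon_grade (F : Finset (Fin n)) : eMonF K n F ∈ eGrade K n F.card := by
  have : ∀ l : List (Fin n), (l.map (eVar K n)).prod ∈ eGrade K n l.length := by
    intro l
    induction l with
    | nil => simp [eGrade]
    | cons i l ih =>
      rw [List.map_cons, List.prod_cons, List.length_cons, eGrade, pow_succ']
      exact Submodule.mul_mem_mul ⟨_, rfl⟩ ih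
  simpa [eMonF] using this (F.sort (· ≤ ·))

/-- induction principle for the ideal -/
theorem aux_ind (G : Finset (Finset (Fin n))) (P : ExtE K n → Prop)
    (h0 : P 0) (ha : ∀ x y, P x → P y → P (x + y)) (hs : ∀ (c : K) x, P x → P (c • x))
    (hg : ∀ F ∈ G, ∀ b, P (eMonF K n F * b)) (x : ExtE K n)
    (hx : x ∈ tsIdeal K n (eMonF K n '' (G : Set (Finset (Fin n))))) : P x := by
  unfold tsIdeal at hx
  induction hx using Submodule.span_induction with
  | mem x h =>
    obtain ⟨a, s, b, ⟨F, hF, rfl⟩, rfl⟩ := h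
    obtain ⟨a', h'⟩ := aux_comm (K := K) (F.sort (· ≤ ·)) a
    have : a * eMonF K n F = eMonF K n F * a' := h'
    rw [this, mul_assoc]
    exact hg F hF _
  | zero => exact h0
  | add x y _ _ hx hy => exact ha x y hx hy
  | smul c x _ hx => exact hs c x hx

theorem aux_gen_mem (G : Finset (Finset (Fin n))) (F) (hF : F ∈ G) (b : ExtE K n) :
    eMonF K n F * b ∈ tsIdeal K n (eMonF K n '' (G : Set (Finset (Fin n)))) :=
  Submodule.subset_span ⟨1, _, b, ⟨F, hF, rfl⟩, by simp⟩

/-- homogeneous component -/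
def auxP (K : Type*) [Field K] (n : ℕ) (i : ℕ) (x : ExtE K n) : ExtE K n :=
  (DirectSum.decompose (fun i : ℕ => ⋀[K]^i (Fin n → K)) x i : ExtE K n)

theorem auxP_same (i : ℕ) (x : ExtE K n) (hx : x ∈ eGrade K n i) : auxP K n i x = x :=
  DirectSum.decompose_of_mem_same (fun i : ℕ => ⋀[K]^i (Fin n → K)) hx

theorem auxP_add (i : ℕ) (x y : ExtE K n) : auxP K n i (x + y) = auxP K n i x + auxP K n i y := by
  simp [auxP, DirectSum.decompose_add]

theorem auxP_smul (i : ℕ) (c : K) (x : ExtE K n) : auxP K n i (c • x) = c • auxP K n i x := by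
  rw [auxP, DirectSum.decompose_smul]
  rfl

theorem auxP_mul_lt (p i : ℕ) (hi : i < p) (a b : ExtE K n) (ha : a ∈ eGrade K n p) :
    auxP K n i (a * b) = 0 :=
  DirectSum.coe_decompose_mul_of_left_mem_of_not_le (fun i : ℕ => ⋀[K]^i (Fin n → K)) ha
    (by omega)

theorem auxP_mul (p i : ℕ) (a b : ExtE K n) (ha : a ∈ eGrade K n p) :
    auxP K n (p + i) (a * b) = a * auxP K n i b :=
  DirectSum.coe_decompose_mul_add_of_left_mem (fun i : ℕ => ⋀[K]^i (Fin n → K)) ha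

theorem auxP_J (G : Finset (Finset (Fin n))) (p i : ℕ) (hi : i < p)
    (hdeg : ∀ F ∈ G, F.card = p) (x : ExtE K n)
    (hx : x ∈ tsIdeal K n (eMonF K n '' (G : Set (Finset (Fin n))))) : auxP K n i x = 0 := by
  refine aux_ind G (fun x => auxP K n i x = 0) (by simp [auxP]) ?_ ?_ ?_ x hx
  · intro x y hx hy; rw [auxP_add, hx, hy, add_zero]
  · intro c x hx; rw [auxP_smul, hx, smul_zero]
  · intro F hF b
    exact auxP_mul_lt p i hi _ _ (hdeg F hF ▸ aux_mon_grade F)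

theorem auxC_J (G : Finset (Finset (Fin n))) (k : Fin n) (hk : ∀ F ∈ G, k ∉ F) (x : ExtE K n)
    (hx : x ∈ tsIdeal K n (eMonF K n '' (G : Set (Finset (Fin n))))) :
    auxC K k x ∈ tsIdeal K n (eMonF K n '' (G : Set (Finset (Fin n)))) := by
  refine aux_ind G (fun x => auxC K k x ∈ tsIdeal K n (eMonF K n '' (G : Set (Finset (Fin n)))))
    (by simp) ?_ ?_ ?_ x hx
  · intro x y hx hy; rw [map_add]; exact Submodule.add_mem _ hx hy
  · intro c x hx; rw [map_smul]; exact Submodule.smul_mem _ _ hx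
  · intro F hF b
    obtain ⟨c, hc⟩ := auxC_list (K := K) k (F.sort (· ≤ ·)) (by simpa using hk F hF) b
    have : auxC K k (eMonF K n F * b) = eMonF K n F * (c • auxC K k b) := hc
    rw [this]
    exact aux_gen_mem G F hF _

theorem aux_sum (x : Fin n → K) : ExteriorAlgebra.ι K x = ∑ j, x j • eVar K n j := by
  conv_lhs => rw [pi_eq_sum_univ' x]
  rw [map_sum]
  refine Finset.sum_congr rfl fun j _ => ?_
  rw [map_smul, eVar]

end helpers

/-- For a stable monomial ideal `J ⊆ E` generated by monomials all of the
same degree `p ≥ 2`, with `t = max{max(u) : u ∈ G(J)}`, the `(p−1)`-st resonance variety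
is maximal: `R^{p−1}(E/J) = V_E(E/J)`, and both equal `span_K{e_1, …, e_t}`. -/
theorem stmt2 {K : Type*} [Field K] [CharZero K] {n : ℕ}
    (G : Finset (Finset (Fin n))) (J : Submodule K (ExtE K n))
    (hJ : J = tsIdeal K n (eMonF K n '' (G : Set (Finset (Fin n)))))
    (hGne : G.Nonempty)
    (p : ℕ) (hp : 2 ≤ p)
    (hdeg : ∀ F ∈ G, F.card = p)
    (hstab : ∀ (F : Finset (Fin n)) (hF : F.Nonempty), eMonF K n F ∈ J →
      ∀ j : Fin n, j < F.max' hF → j ∉ F →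
        eMonF K n (insert j (F.erase (F.max' hF))) ∈ J)
    (t : Fin n)
    (ht : IsGreatest {i : Fin n | ∃ F ∈ G, i ∈ F} t) :
    resonanceQ K n J (p - 1) = rankVar K n J ∧
    resonanceQ K n J (p - 1) =
      (Submodule.span K (eVar K n '' {i : Fin n | i ≤ t}) : Set (ExtE K n)) := by
  have hRV : resonanceQ K n J (p - 1) ⊆ rankVar K n J := by
    rintro u ⟨hu1, hu⟩
    refine ⟨hu1, ?_⟩
    rcases hu with rfl | ⟨v, hv, hvJ, -, huv, hne⟩
    · refine ⟨1, by simp, ?_⟩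
      rintro ⟨j, hj, x, h⟩
      rw [zero_mul, add_zero] at h
      subst h
      rw [hJ] at hj
      have h1 := auxP_J G p 0 (by omega) hdeg _ hj
      rw [auxP_same 0 1 (by simp [eGrade])] at h1
      exact one_ne_zero h1
    · refine ⟨v, huv, ?_⟩
      rintro ⟨j, hj, x, h⟩
      have h1 := congrArg (auxP K n (p - 1)) h
      rw [hJ] at hj
      rw [auxP_same _ _ hv, auxP_add, auxP_J G p (p - 1) (by omega) hdeg _ hj, zero_add,
        show p - 1 = 1 + (p - 2) by omega, auxP_mul 1 (p - 2) _ _ hu1] at h1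
      apply hne
      rw [eGrade, pow_one] at hu1
      obtain ⟨y, rfl⟩ := hu1
      rw [h1, ← mul_assoc, ExteriorAlgebra.ι_sq_zero, zero_mul]
  have hVS : rankVar K n J ⊆
      (Submodule.span K (eVar K n '' {i : Fin n | i ≤ t}) : Set (ExtE K n)) := by
    rintro u ⟨hu1, w, hw, hn⟩
    rw [eGrade, pow_one] at hu1
    obtain ⟨x, rfl⟩ := hu1
    by_cases hx : ∀ k, t < k → x k = 0
    · rw [SetLike.mem_coe, aux_sum]
      refine Submodule.sum_mem _ fun j _ => ?_
      by_cases hj : j ≤ t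
      · exact Submodule.smul_mem _ _ (Submodule.subset_span ⟨j, hj, rfl⟩)
      · rw [hx j (not_le.mp hj), zero_smul]; exact Submodule.zero_mem _
    · exfalso
      push Not at hx
      obtain ⟨k, hk, hxk⟩ := hx
      have hkG : ∀ F ∈ G, k ∉ F := fun F hF hkF => absurd (ht.2 ⟨F, hF, hkF⟩) (not_le.mpr hk)
      have h1 := auxC_mul k x w
      have h2 : auxC K k (ExteriorAlgebra.ι K x * w) ∈ J := by
        rw [hJ] at hw ⊢
        exact auxC_J G k hkG _ hw
      apply hn
      refine ⟨(x k)⁻¹ • auxC K k (ExteriorAlgebra.ι K x * w), Submodule.smul_mem _ _ h2,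
        (x k)⁻¹ • auxC K k w, ?_⟩
      rw [h1, smul_sub, smul_smul, inv_mul_cancel₀ hxk, one_smul, mul_smul_comm, sub_add_cancel]
  have hSR : (Submodule.span K (eVar K n '' {i : Fin n | i ≤ t}) : Set (ExtE K n)) ⊆
      resonanceQ K n J (p - 1) := by
    intro u hu
    have hu' : ∃ x : Fin n → K, (∀ k, t < k → x k = 0) ∧ u = ExteriorAlgebra.ι K x := by
      rw [SetLike.mem_coe] at hu
      induction hu using Submodule.span_induction with
      | mem u h =>
        obtain ⟨i, hi, rfl⟩ := h
        refine ⟨Pi.single i 1, fun k hk => Pi.single_eq_of_ne (ne_of_gt (lt_of_le_of_lt hi hk)) _, rfl⟩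
      | zero => exact ⟨0, by simp, by simp⟩
      | add u v _ _ hu hv =>
        obtain ⟨x, hx, rfl⟩ := hu
        obtain ⟨y, hy, rfl⟩ := hv
        exact ⟨x + y, fun k hk => by simp [hx k hk, hy k hk], by simp⟩
      | smul c u _ hu =>
        obtain ⟨x, hx, rfl⟩ := hu
        exact ⟨c • x, fun k hk => by simp [hx k hk], by simp⟩
    obtain ⟨x, hx, rfl⟩ := hu'
    refine ⟨by rw [eGrade, pow_one]; exact ⟨x, rfl⟩, ?_⟩
    by_cases hx0 : x = 0
    · left; simp [hx0]
    right
    -- reduce to a suitable monomial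
    suffices h : ∃ (H : Finset (Fin n)) (k : Fin n), H.card = p - 1 ∧ k ∉ H ∧ x k ≠ 0 ∧
        ∀ j, j ∉ H → x j ≠ 0 → eMonF K n (insert j H) ∈ J by
      obtain ⟨H, k, hH, hkH, hxk, hins⟩ := h
      have hne := aux_mul_ne x k hxk H hkH
      have hg : eMonF K n H ∈ eGrade K n (p - 1) := hH ▸ aux_mon_grade H
      refine ⟨eMonF K n H, hg, ?_, ?_, ?_, hne⟩
      · intro hmem
        rw [hJ] at hmem
        have h1 := auxP_J G p (p - 1) (by omega) hdeg _ hmem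
        rw [auxP_same _ _ hg] at h1
        exact hne (by rw [h1, mul_zero])
      · rintro ⟨w, -, hw⟩
        apply hne
        rw [hw, ← mul_assoc, ExteriorAlgebra.ι_sq_zero, zero_mul]
      · rw [aux_sum, Finset.sum_mul]
        refine Submodule.sum_mem _ fun j _ => ?_
        rw [smul_mul_assoc]
        by_cases hxj : x j = 0
        · rw [hxj, zero_smul]; exact Submodule.zero_mem _
        apply Submodule.smul_mem
        by_cases hj : j ∈ H
        · rw [aux_mul_mem j H hj]; exact Submodule.zero_mem _
        · obtain ⟨c, hc⟩ := aux_insert (K := K) j H hj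
          rw [hc]
          exact Submodule.smul_mem _ _ (hins j hj hxj)
    obtain ⟨F, hF, htF⟩ := ht.1
    have hFJ : eMonF K n F ∈ J := by
      rw [hJ]; simpa using aux_gen_mem (K := K) G F hF 1
    have hFne : F.Nonempty := ⟨t, htF⟩
    have hmax : F.max' hFne = t :=
      le_antisymm (ht.2 ⟨F, hF, Finset.max'_mem _ _⟩) (Finset.le_max' _ _ htF)
    by_cases hc : ∃ k, k ∉ F.erase t ∧ x k ≠ 0
    · obtain ⟨k, hk, hxk⟩ := hc
      refine ⟨F.erase t, k, by rw [Finset.card_erase_of_mem htF, hdeg F hF], hk, hxk, ?_⟩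
      intro j hj hxj
      by_cases hjt : j = t
      · subst hjt; rwa [Finset.insert_erase htF]
      · have hle : j ≤ t := not_lt.mp fun h => hxj (hx j h)
        have := hstab F hFne hFJ j (by rw [hmax]; exact lt_of_le_of_ne hle hjt)
          (fun h => hj (Finset.mem_erase.mpr ⟨hjt, h⟩))
        rwa [hmax] at this
    · push Not at hc
      obtain ⟨i, hi⟩ := Function.ne_iff.mp hx0
      have hiF : i ∈ F := by
        by_contra h
        exact hi (hc i fun h' => h (Finset.mem_of_mem_erase h'))
      refine ⟨F.erase i, i, by rw [Finset.card_erase_of_mem hiF, hdeg F hF], by simp, hi, ?_⟩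
      intro j hj hxj
      have hjF : j ∈ F := by
        by_contra h
        exact hxj (hc j fun h' => h (Finset.mem_of_mem_erase h'))
      have : j = i := by
        by_contra h
        exact hj (Finset.mem_erase.mpr ⟨h, hjF⟩)
      subst this
      rwa [Finset.insert_erase hiF]
  have h1 : resonanceQ K n J (p - 1) = rankVar K n J :=
    Set.Subset.antisymm hRV (hVS.trans hSR)
  exact ⟨h1, Set.Subset.antisymm (hRV.trans hVS) hSR⟩
end
end

section
/- Let l_1, …, l_t ∈ E_1 be linearly independent linear forms and let 𝔞 = (l_1, …, l_t) be the two-sided ideal of E they generate. Then for every integer d ≥ 1, the d-th power 𝔞^d equals the two-sided ideal of E generated by the products l_{j_1} ∧ l_{j_2} ∧ ⋯ ∧ l_{j_d} over all 1 ≤ j_1 < j_2 < ⋯ < j_d ≤ t. In particular, for the coordinate forms l_i = e_i one has (e_1, …, e_t)^d = (e_F : F ⊆ {1,…,t}, |F| = d). -/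
open scoped BigOperators

noncomputable section

theorem aux_comm_s14 {K : Type*} [Field K] {n : ℕ} (v : Fin n → K) (c : ExtE K n) :
    ∃ c' : ExtE K n, c * ExteriorAlgebra.ι K v = ExteriorAlgebra.ι K v * c' := by
  induction c using ExteriorAlgebra.induction with
  | algebraMap r => exact ⟨algebraMap _ _ r, Algebra.commutes r _⟩
  | ι x =>
    refine ⟨-ExteriorAlgebra.ι K x, ?_⟩
    rw [mul_neg]
    exact eq_neg_of_add_eq_zero_left (ExteriorAlgebra.ι_add_mul_swap x v)
  | mul a b ha hb =>
    obtain ⟨a', ha⟩ := ha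
    obtain ⟨b', hb⟩ := hb
    exact ⟨a' * b', by rw [mul_assoc, hb, ← mul_assoc, ha, mul_assoc]⟩
  | add a b ha hb =>
    obtain ⟨a', ha⟩ := ha
    obtain ⟨b', hb⟩ := hb
    exact ⟨a' + b', by rw [add_mul, ha, hb, mul_add]⟩

theorem aux_perm_s14 {K : Type*} [Field K] {n t : ℕ} (v : Fin t → (Fin n → K))
    {L L' : List (Fin t)} (h : L.Perm L') :
    ∃ u : K, (L.map (fun j => ExteriorAlgebra.ι K (v j))).prod =
      u • (L'.map (fun j => ExteriorAlgebra.ι K (v j))).prod := by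
  induction h with
  | nil => exact ⟨1, by simp⟩
  | cons x _ ih =>
    obtain ⟨u, hu⟩ := ih
    exact ⟨u, by simp only [List.map_cons, List.prod_cons]; rw [hu, mul_smul_comm]⟩
  | swap x y l =>
    refine ⟨-1, ?_⟩
    simp only [List.map_cons, List.prod_cons]
    rw [← mul_assoc, ← mul_assoc, eq_neg_of_add_eq_zero_left
      (ExteriorAlgebra.ι_add_mul_swap (v y) (v x)), neg_mul, neg_smul, one_smul]
  | trans _ _ h1 h2 =>
    obtain ⟨u, hu⟩ := h1
    obtain ⟨w, hw⟩ := h2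
    exact ⟨u * w, by rw [hu, hw, smul_smul]⟩

theorem aux_list {K : Type*} [Field K] {n t : ℕ} (l : Fin t → ExtE K n) (i : Fin t)
    (L : List (Fin t)) : ∀ (i : Fin t) (a b : ExtE K n),
    a * ((i :: L).map l).prod * b ∈ (tsIdeal K n (Set.range l)) ^ (L.length + 1) := by
  induction L with
  | nil =>
    intro i a b
    simp only [List.length_nil, zero_add, pow_one]
    exact Submodule.subset_span ⟨a, l i, b, ⟨i, rfl⟩, by simp⟩
  | cons k L ih =>
    intro i a b
    rw [List.length_cons, pow_succ']
    have e : a * ((i :: k :: L).map l).prod * b =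
        (a * l i * 1) * (1 * ((k :: L).map l).prod * b) := by
      rw [List.map_cons, List.prod_cons]; simp only [mul_assoc, one_mul]
    rw [e]
    exact Submodule.mul_mem_mul (Submodule.subset_span ⟨a, l i, 1, ⟨i, rfl⟩, rfl⟩) (ih k 1 b)

theorem aux_main {K : Type*} [Field K] {n t : ℕ} (v : Fin t → (Fin n → K)) (s : Finset (Fin t))
    (j : Fin t) (a b c : ExtE K n) :
    a * ((s.sort (· ≤ ·)).map (fun j => ExteriorAlgebra.ι K (v j))).prod * c
      * ExteriorAlgebra.ι K (v j) * b ∈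
      tsIdeal K n {x : ExtE K n | ∃ s' : Finset (Fin t), s'.card = s.card + 1 ∧
        x = ((s'.sort (· ≤ ·)).map (fun j => ExteriorAlgebra.ι K (v j))).prod} := by
  obtain ⟨c', hc⟩ := aux_comm_s14 (v j) c
  have e : a * ((s.sort (· ≤ ·)).map (fun j => ExteriorAlgebra.ι K (v j))).prod * c
      * ExteriorAlgebra.ι K (v j) * b =
      a * ((s.sort (· ≤ ·) ++ [j]).map (fun j => ExteriorAlgebra.ι K (v j))).prod * (c' * b) := by
    rw [mul_assoc _ c, hc, List.map_append, List.prod_append]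
    simp [mul_assoc]
  rw [e]
  by_cases hj : j ∈ s
  · have hp : (s.sort (· ≤ ·) ++ [j]).Perm (j :: j :: (s.sort (· ≤ ·)).erase j) :=
      (List.perm_append_singleton _ _).trans
        ((List.perm_cons_erase ((Finset.mem_sort _).2 hj)).cons j)
    obtain ⟨u, hu⟩ := aux_perm_s14 v hp
    rw [hu]
    simp only [List.map_cons, List.prod_cons]
    rw [← mul_assoc (ExteriorAlgebra.ι K (v j)), ExteriorAlgebra.ι_sq_zero]
    simp
  · have hp : (s.sort (· ≤ ·) ++ [j]).Perm ((insert j s).sort (· ≤ ·)) := by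
      refine (List.perm_append_singleton _ _).trans ?_
      rw [List.perm_ext_iff_of_nodup]
      · intro x; simp
      · simp [hj]
      · exact Finset.sort_nodup _ _
    obtain ⟨u, hu⟩ := aux_perm_s14 v hp
    rw [hu, mul_smul_comm, smul_mul_assoc]
    exact Submodule.smul_mem _ _ (Submodule.subset_span
      ⟨a, _, c' * b, ⟨insert j s, Finset.card_insert_of_notMem hj, rfl⟩, rfl⟩)

/-- If `l_1, …, l_t ∈ E_1` are linearly independent and
`𝔞 = (l_1, …, l_t)`, then for every `d ≥ 1` the power `𝔞^d` equals the two-sided ideal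
generated by the products `l_{j_1} ∧ ⋯ ∧ l_{j_d}` over `j_1 < ⋯ < j_d`. -/
theorem stmt14 {K : Type*} [Field K] [CharZero K] {n t : ℕ}
    (l : Fin t → ExtE K n)
    (hl1 : ∀ j : Fin t, l j ∈ eGrade K n 1)
    (hli : LinearIndependent K l)
    (d : ℕ) (hd : 1 ≤ d) :
    (tsIdeal K n (Set.range l)) ^ d =
      tsIdeal K n {x : ExtE K n | ∃ s : Finset (Fin t), s.card = d ∧
        x = ((s.sort (· ≤ ·)).map l).prod} := by
  have hv : ∀ j, ∃ w : Fin n → K, ExteriorAlgebra.ι K w = l j := by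
    intro j
    have := hl1 j
    rw [eGrade, pow_one] at this
    exact this
  choose v hv using hv
  obtain rfl : (fun j => ExteriorAlgebra.ι K (v j)) = l := funext hv
  apply le_antisymm
  · induction d, hd using Nat.le_induction with
    | base =>
      rw [pow_one]
      refine Submodule.span_mono ?_
      rintro x ⟨a, s, b, ⟨j, rfl⟩, rfl⟩
      exact ⟨a, _, b, ⟨{j}, by simp, rfl⟩, by simp⟩
    | succ d hd ih =>
      rw [pow_succ]
      refine (mul_le_mul' ih le_rfl).trans ?_
      conv_lhs => rw [tsIdeal, tsIdeal]
      rw [Submodule.span_mul_span, Submodule.span_le]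
      rintro _ ⟨_, ⟨a, _, b, ⟨s, hs, rfl⟩, rfl⟩, _, ⟨a', _, b', ⟨j, rfl⟩, rfl⟩, rfl⟩
      have := aux_main v s j a b' (b * a')
      rw [hs] at this
      simpa only [mul_assoc, SetLike.mem_coe] using this
  · refine Submodule.span_le.2 ?_
    rintro _ ⟨a, _, b, ⟨s, hs, rfl⟩, rfl⟩
    have hlen : (s.sort (· ≤ ·)).length = d := by rw [Finset.length_sort, hs]
    cases hL : s.sort (· ≤ ·) with
    | nil => rw [hL] at hlen; simp at hlen; omega
    | cons i L =>
      rw [hL, List.length_cons] at hlen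
      rw [← hlen]
      exact aux_list _ i L i a b
end
end
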